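/- arXiv:2009.11546 — 4 statements merged into one kernel-verified Lean document; each statement's English description precedes it below -/
import Mathlib

section
/- Let P be an additive commutative group (viewed as a ℤ-module), G Q : P, β n : ℕ, and let π₁, …, π_n be permutations of Fin β. Let R : Fin β → P and x₀ : Fin β → ℤ, and for each i = 1, …, n let s_i : Fin β → P and y_i : Fin β → ℤ. Define plaintext vectors P₀ = R and P_i = π_i • P_{i-1} + s_i, randomness vectors X₀ = x₀ and X_i = π_i • X_{i-1} + y_i, and ciphertext vectors Ĉ₀ = (j ↦ (x₀ j • G, R j + x₀ j • Q)) and Ĉ_i = π_i • Ĉ_{i-1} + (j ↦ (y_i j • G, s_i j + y_i j • Q)), where ciphertext pairs are added componentwise and π acts on a vector of pairs coordinatewise. Then for every i ≤ n and every j, Ĉ_i j = (X_i j • G, P_i j + X_i j • Q). In particular the output of the precomputation Mix step is a valid ElGamal encryption of Π_n(R) blinded by the accumulated S-values, i.e. of P_n. -/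
/-- Invariant of the precomputation `Mix` step: if the plaintext chain is `P₀ = R`,
`P_{i+1} = π_{i+1} • P_i + s_{i+1}`, the randomness chain is `X₀ = x₀`,
`X_{i+1} = π_{i+1} • X_i + y_{i+1}`, and the ciphertext chain is
`Ĉ₀ = (j ↦ (x₀ j • G, R j + x₀ j • Q))`,
`Ĉ_{i+1} = π_{i+1} • Ĉ_i + (j ↦ (y_{i+1} j • G, s_{i+1} j + y_{i+1} j • Q))`
(componentwise addition of pairs, permutations acting by `(π • v) j = v (π⁻¹ j)`),
then for every `i ≤ n` and every `j`, `Ĉ_i j = (X_i j • G, P_i j + X_i j • Q)`. -/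
theorem precomputation_mix_invariant {P : Type*} [AddCommGroup P] (G Q : P) (β n : ℕ)
    (π : ℕ → Equiv.Perm (Fin β)) (R : Fin β → P) (x₀ : Fin β → ℤ)
    (s : ℕ → Fin β → P) (y : ℕ → Fin β → ℤ)
    (Pl : ℕ → Fin β → P) (X : ℕ → Fin β → ℤ) (C : ℕ → Fin β → P × P)
    (hPl0 : Pl 0 = R) (hX0 : X 0 = x₀)
    (hC0 : ∀ j, C 0 j = (x₀ j • G, R j + x₀ j • Q))
    (hPl : ∀ i < n, ∀ j, Pl (i + 1) j = Pl i ((π (i + 1))⁻¹ j) + s (i + 1) j)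
    (hX : ∀ i < n, ∀ j, X (i + 1) j = X i ((π (i + 1))⁻¹ j) + y (i + 1) j)
    (hC : ∀ i < n, ∀ j, C (i + 1) j
        = C i ((π (i + 1))⁻¹ j) + (y (i + 1) j • G, s (i + 1) j + y (i + 1) j • Q)) :
    ∀ i ≤ n, ∀ j, C i j = (X i j • G, Pl i j + X i j • Q) := by
  intro i
  induction i with
  | zero =>
    intro _ j
    rw [hC0, hX0, hPl0]
  | succ k ih =>
    intro hk j
    have hk' : k < n := hk
    rw [hC k hk', hX k hk', hPl k hk', ih hk'.le, Prod.mk_add_mk, add_smul, add_smul,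
      add_add_add_comm]
end

section
/- Let P be an additive commutative group, β n : ℕ, let π₁, …, π_n be permutations of Fin β acting on vectors by (π • v) j = v (π⁻¹ j), and let M, R : Fin β → P and s₁, …, s_n : Fin β → P. Define the real-time chain mix₀ = M + R and mix_i = π_i • mix_{i-1} + s_i, and the precomputation chain P₀ = R and P_i = π_i • P_{i-1} + s_i. Then for every i ≤ n, mix_i = Π_i • M + P_i, where Π_i • M = π_i • (π_{i-1} • (⋯ • (π₁ • M))) (and Π₀ • M = M). In particular mix_n = Π_n • M + P_n: the real-time mixing output is exactly the permuted message vector blinded by the precomputed value P_n = Π_n(R) + S_n. -/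
/-- Action of a permutation of the slots on a vector: `(π • v) j = v (π⁻¹ j)`. -/
def permAct {β : ℕ} {P : Type*} (π : Equiv.Perm (Fin β)) (v : Fin β → P) : Fin β → P :=
  fun j => v (π⁻¹ j)

/-- `prodUpTo π i = π i * π (i-1) * ⋯ * π 1`, so that acting with it on a vector `M`
gives `π_i • (π_{i-1} • (⋯ • (π₁ • M)))`; `prodUpTo π 0 = 1` acts as the identity. -/
def prodUpTo {β : ℕ} (π : ℕ → Equiv.Perm (Fin β)) : ℕ → Equiv.Perm (Fin β)
  | 0 => 1
  | (i + 1) => π (i + 1) * prodUpTo π i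

/-- The real-time mixing chain `mix₀ = M + R`, `mix_i = π_i • mix_{i-1} + s_i` tracks the
precomputation chain `P₀ = R`, `P_i = π_i • P_{i-1} + s_i`: for every `i ≤ n`,
`mix_i = Π_i • M + P_i` where `Π_i • M = π_i • (π_{i-1} • (⋯ • (π₁ • M)))`.
In particular `mix_n = Π_n • M + P_n`. -/
theorem realtime_mix_eq_permuted_plus_precomputed {P : Type*} [AddCommGroup P]
    (β n : ℕ) (π : ℕ → Equiv.Perm (Fin β)) (M R : Fin β → P) (s : ℕ → Fin β → P)
    (mix Pl : ℕ → Fin β → P)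
    (hmix0 : mix 0 = M + R)
    (hmix : ∀ i < n, mix (i + 1) = permAct (π (i + 1)) (mix i) + s (i + 1))
    (hPl0 : Pl 0 = R)
    (hPl : ∀ i < n, Pl (i + 1) = permAct (π (i + 1)) (Pl i) + s (i + 1)) :
    ∀ i ≤ n, mix i = permAct (prodUpTo π i) M + Pl i := by
  intro i
  induction i with
  | zero =>
    intro _
    rw [hmix0, hPl0]
    rfl
  | succ k ih =>
    intro hk
    rw [hmix k hk, hPl k hk, ih (Nat.le_of_lt hk)]
    funext j
    simp [permAct, prodUpTo, mul_inv_rev, add_assoc]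
end

section
/- Correctness of the additive homomorphism mix-net protocol Δ: let P be an additive commutative group (viewed as a ℤ-module), G : P, β n : ℕ, and let d₁, …, d_n : ℤ be the mix nodes' secret shares with joint public key Q = ∑_{i=1}^n d_i • G. Let π₁, …, π_n be permutations of Fin β acting on vectors by (π • v) j = v (π⁻¹ j), let M : Fin β → P be the vector of user messages, and for each node i let k_i, r_i, s_i : Fin β → P be its shared-key, r-, and s-vectors; set K = ∑_{i=1}^n k_i and R = ∑_{i=1}^n r_i. Define mix₀ = (M - K) + ∑_{i=1}^n (k_i + r_i), mix_i = π_i • mix_{i-1} + s_i, and P₀ = R, P_i = π_i • P_{i-1} + s_i. Let x : Fin β → ℤ and let (X, c) = (j ↦ x j • G, j ↦ -(P_n j) + x j • Q) be the precomputed ElGamal encryption of -P_n under Q. Then mix_n + c - ∑_{i=1}^n (j ↦ d_i • X j) = Π_n • M, where Π_n • M = π_n • (π_{n-1} • (⋯ • (π₁ • M))). That is, after the users blind their messages with K⁻¹, the nodes unblind with k_i + r_i, mix, and then apply their decryption shares to the precomputed ciphertext, the published output is exactly the vector of messages permuted by Π_n = π_n ∘ ⋯ ∘ π₁. -/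
/-- Correctness of the additive homomorphism mix-net protocol Δ: with joint public key
`Q = ∑ d_i • G`, slot keys `K = ∑ k_i`, random values `R = ∑ r_i`, real-time chain
`mix₀ = (M - K) + ∑ (k_i + r_i)`, `mix_i = π_i • mix_{i-1} + s_i`, precomputation chain
`P₀ = R`, `P_i = π_i • P_{i-1} + s_i`, and precomputed ElGamal encryption
`(X, c) = (j ↦ x j • G, j ↦ -(P_n j) + x j • Q)` of `-P_n`, adding the message component
`c` to `mix_n` and subtracting all decryption shares `d_i • X j` yields exactly the
permuted message vector `Π_n • M = π_n • (⋯ • (π₁ • M))`. -/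
theorem mixnet_protocol_correctness {P : Type*} [AddCommGroup P] (G : P) (β n : ℕ)
    (d : ℕ → ℤ) (Q : P) (hQ : Q = ∑ i ∈ Finset.Icc 1 n, d i • G)
    (π : ℕ → Equiv.Perm (Fin β)) (M : Fin β → P)
    (k r s : ℕ → Fin β → P) (K R : Fin β → P)
    (hK : K = ∑ i ∈ Finset.Icc 1 n, k i)
    (hR : R = ∑ i ∈ Finset.Icc 1 n, r i)
    (mix Pl : ℕ → Fin β → P)
    (hmix0 : mix 0 = (M - K) + ∑ i ∈ Finset.Icc 1 n, (k i + r i))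
    (hmix : ∀ i < n, mix (i + 1) = permAct (π (i + 1)) (mix i) + s (i + 1))
    (hPl0 : Pl 0 = R)
    (hPl : ∀ i < n, Pl (i + 1) = permAct (π (i + 1)) (Pl i) + s (i + 1))
    (x : Fin β → ℤ) (X c : Fin β → P)
    (hX : X = fun j => x j • G)
    (hc : c = fun j => -(Pl n j) + x j • Q) :
    mix n + c - ∑ i ∈ Finset.Icc 1 n, (fun j => d i • X j) = permAct (prodUpTo π n) M := by
  have key : ∀ i, i ≤ n → ∀ j, mix i j = permAct (prodUpTo π i) M j + Pl i j := by
    intro i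
    induction i with
    | zero =>
      intro _ j
      rw [hmix0, hPl0, hR, hK, Finset.sum_add_distrib]
      simp [permAct, prodUpTo]
      abel
    | succ m ih =>
      intro hm j
      rw [hmix m (by omega), hPl m (by omega)]
      simp only [Pi.add_apply, permAct, prodUpTo, mul_inv_rev, Equiv.Perm.mul_apply]
      rw [ih (by omega)]
      simp only [permAct]
      abel
  have hdec : ∀ j, ∑ i ∈ Finset.Icc 1 n, d i • x j • G = x j • Q := by
    intro j
    rw [hQ, Finset.smul_sum]
    exact Finset.sum_congr rfl fun i _ => smul_comm _ _ _
  funext j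
  simp only [Pi.sub_apply, Pi.add_apply, Finset.sum_apply, hX, hc]
  rw [hdec, key n le_rfl j]
  abel
end

section
/- Collision tagging attack on the mix-net (undetectability of the tag): let P be an additive commutative group, β n : ℕ, let π₁, …, π_n be permutations of Fin β acting on vectors by (π • v) j = v (π⁻¹ j), let M, R : Fin β → P, s₁, …, s_n : Fin β → P, and consider the honest chain mix₀ = M + R, mix_i = π_i • mix_{i-1} + s_i. Fix a compromised node index ℓ ∈ {1, …, n}, a slot a : Fin β, and a tag t : P, and define the tampered chain mix'_i by mix'_i = mix_i for i < ℓ, mix'_ℓ = π_ℓ • (mix_{ℓ-1} + δ_{a,t}) + s_ℓ, and mix'_i = π_i • mix'_{i-1} + s_i for i > ℓ, where δ_{a,t} : Fin β → P is the vector equal to t at coordinate a and 0 elsewhere. Let b = π_n (π_{n-1} (⋯ (π_ℓ a))). Then mix'_n = mix_n + δ_{b,t}; consequently, if the colluding node subtracts t at position b before publishing (equivalently, multiplies its decryption share by the tag's inverse at that slot), the published output mix'_n - δ_{b,t} - P_n equals the honest output Π_n • M (where P₀ = R, P_i = π_i • P_{i-1} + s_i and Π_n • M = π_n • (⋯ •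 (π₁ • M))). Thus the attack is undetectable from the output, while the colluding nodes learn that output slot b corresponds to the message occupying slot a at node ℓ's input, breaking unlinkability. -/
/-- `suffixComp π i n = π n * π (n-1) * ⋯ * π (i+1)`, the composition of the
permutations with indices from `i+1` up to `n` (the identity if `n ≤ i`). -/
def suffixComp {β : ℕ} (π : ℕ → Equiv.Perm (Fin β)) (i : ℕ) : ℕ → Equiv.Perm (Fin β)
  | 0 => 1
  | (m + 1) => if m + 1 ≤ i then 1 else π (m + 1) * suffixComp π i m

/-- The vector equal to `t` at coordinate `a` and `0` elsewhere. -/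
def delta {β : ℕ} {P : Type*} [Zero P] (a : Fin β) (t : P) : Fin β → P :=
  fun j => if j = a then t else 0

theorem permAct_add' {β : ℕ} {P : Type*} [AddCommGroup P] (π : Equiv.Perm (Fin β))
    (v w : Fin β → P) : permAct π (v + w) = permAct π v + permAct π w := rfl

theorem permAct_delta' {β : ℕ} {P : Type*} [AddCommGroup P] (π : Equiv.Perm (Fin β))
    (a : Fin β) (t : P) : permAct π (delta a t) = delta (π a) t := by
  funext j
  simp only [permAct, delta, Equiv.Perm.inv_eq_iff_eq]

theorem suffixComp_self' {β : ℕ} (π : ℕ → Equiv.Perm (Fin β)) (i : ℕ) :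
    suffixComp π i i = 1 := by
  cases i <;> simp [suffixComp]

theorem suffixComp_succ' {β : ℕ} (π : ℕ → Equiv.Perm (Fin β)) (i m : ℕ) (h : i ≤ m) :
    suffixComp π i (m + 1) = π (m + 1) * suffixComp π i m := by
  rw [suffixComp, if_neg (by omega)]

/-- Collision tagging attack on the mixing chain: if the compromised node `ℓ` adds a tag
`t` at slot `a` before its mixing step, i.e. the tampered chain satisfies
`mix'_i = mix_i` for `i < ℓ`, `mix'_ℓ = π_ℓ • (mix_{ℓ-1} + δ_{a,t}) + s_ℓ`, and
`mix'_i = π_i • mix'_{i-1} + s_i` for `i > ℓ`, then with `b = π_n (π_{n-1} (⋯ (π_ℓ a)))`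
we have `mix'_n = mix_n + δ_{b,t}`; consequently subtracting the tag at position `b`
before publishing yields `mix'_n - δ_{b,t} - P_n = Π_n • M`, the honest output, so the
attack is undetectable from the output. -/
theorem collision_tagging_attack {P : Type*} [AddCommGroup P] (β n : ℕ)
    (π : ℕ → Equiv.Perm (Fin β)) (M R : Fin β → P) (s : ℕ → Fin β → P)
    (mix mix' Pl : ℕ → Fin β → P)
    (ℓ : ℕ) (hℓ1 : 1 ≤ ℓ) (hℓn : ℓ ≤ n) (a : Fin β) (t : P)
    (hmix0 : mix 0 = M + R)
    (hmix : ∀ i < n, mix (i + 1) = permAct (π (i + 1)) (mix i) + s (i + 1))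
    (hPl0 : Pl 0 = R)
    (hPl : ∀ i < n, Pl (i + 1) = permAct (π (i + 1)) (Pl i) + s (i + 1))
    (hmix'lt : ∀ i < ℓ, mix' i = mix i)
    (hmix'ℓ : mix' ℓ = permAct (π ℓ) (mix (ℓ - 1) + delta a t) + s ℓ)
    (hmix'gt : ∀ i, ℓ ≤ i → i < n → mix' (i + 1) = permAct (π (i + 1)) (mix' i) + s (i + 1)) :
    mix' n = mix n + delta (suffixComp π (ℓ - 1) n a) t ∧
      mix' n - delta (suffixComp π (ℓ - 1) n a) t - Pl n = permAct (prodUpTo π n) M := by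
  have key : ∀ m, ℓ ≤ m → m ≤ n → mix' m = mix m + delta (suffixComp π (ℓ - 1) m a) t := by
    intro m hm
    induction m, hm using Nat.le_induction with
    | base =>
      intro _
      obtain ⟨k, rfl⟩ : ∃ k, ℓ = k + 1 := ⟨ℓ - 1, by omega⟩
      rw [hmix'ℓ, Nat.add_sub_cancel, suffixComp_succ' π k k le_rfl, suffixComp_self',
        hmix k (by omega), permAct_add', permAct_delta', mul_one]
      abel
    | succ m hm ih =>
      intro hmn
      rw [hmix'gt m hm (by omega), ih (by omega), hmix m (by omega),
        suffixComp_succ' π (ℓ - 1) m (by omega), permAct_add', permAct_delta',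
        Equiv.Perm.mul_apply]
      abel
  have hon : ∀ m, m ≤ n → mix m = permAct (prodUpTo π m) M + Pl m := by
    intro m
    induction m with
    | zero =>
      intro _
      rw [hmix0, hPl0]
      rfl
    | succ m ih =>
      intro hmn
      have h : permAct (prodUpTo π (m + 1)) M
          = permAct (π (m + 1)) (permAct (prodUpTo π m) M) := by
        funext j
        simp [permAct, prodUpTo, mul_inv_rev]
      rw [hmix m (by omega), ih (by omega), hPl m (by omega), permAct_add', h]
      abel
  refine ⟨key n hℓn le_rfl, ?_⟩
  rw [key n hℓn le_rfl, hon n le_rfl]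
  abel
end
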